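/- arXiv:1610.04672 — 6 statements merged into one kernel-verified Lean document; each statement's English description precedes it below -/
import Mathlib

section
/- Let G be a finite r-regular simple graph with adjacency matrix A, and let Ã^{(n)}(u,v) denote the number of non-backtracking walks of length n from u to v. Then for all n ≥ 1 and all vertices u,v: Ã^{(n)}(u,v) = Σ_{i=0}^{⌊n/2⌋} (−1)^i · C(n−i, i) · (r−1)^i · A^{n−2i}(u,v) − Σ_{i=0}^{⌊n/2⌋−1} (−1)^i · C(n−i−2, i) · (r−1)^i · A^{n−2i−2}(u,v), where A^{m}(u,v) is the (u,v) entry of the m-th power of the adjacency matrix (the number of walks of length m from u to v) and C(a,b) denotes the binomial coefficient. -/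
/-- A walk is non-backtracking if no vertex equals the vertex two steps earlier. -/
def SimpleGraph.Walk.IsNonBacktracking {V : Type*} {G : SimpleGraph V} {u v : V}
    (p : G.Walk u v) : Prop :=
  ∀ i, i + 2 ≤ p.length → p.getVert (i + 2) ≠ p.getVert i

/-- The number of non-backtracking walks of length `k` from `u` to `v` in `G`. -/
noncomputable def nbWalkCount {V : Type*} (G : SimpleGraph V) (u v : V) (k : ℕ) : ℕ :=
  Nat.card {p : G.Walk u v // p.length = k ∧ p.IsNonBacktracking}

open Finset

/-- Chebyshev-like polynomials of the second kind `U n`, normalised so that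
`U (n + 2) = x * U (n + 1) - c • U n`. -/
def chebyshevSum {R : Type*} [Ring R] (c : ℤ) (x : R) (n : ℕ) : R :=
  ∑ i ∈ range (n / 2 + 1), ((-1) ^ i * ((n - i).choose i : ℤ) * c ^ i) • x ^ (n - 2 * i)

theorem chebyshevSum_eq_sum_range {R : Type*} [Ring R] (c : ℤ) (x : R) {n m : ℕ}
    (h : n / 2 < m) :
    chebyshevSum c x n =
      ∑ i ∈ range m, ((-1) ^ i * ((n - i).choose i : ℤ) * c ^ i) • x ^ (n - 2 * i) := by
  refine sum_subset (range_subset_range.2 h) fun i _ hi => ?_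
  have hi' : n - i < i := by
    rw [mem_range] at hi
    omega
  simp [Nat.choose_eq_zero_of_lt hi']

theorem chebyshevSum_add_two {R : Type*} [Ring R] (c : ℤ) (x : R) (n : ℕ) :
    chebyshevSum c x (n + 2) = x * chebyshevSum c x (n + 1) - c • chebyshevSum c x n := by
  rw [chebyshevSum_eq_sum_range c x (show (n + 2) / 2 < n + 1 + 1 by omega),
    chebyshevSum_eq_sum_range c x (show (n + 1) / 2 < n + 1 + 1 by omega),
    chebyshevSum_eq_sum_range c x (show n / 2 < n + 1 by omega),
    sum_range_succ', sum_range_succ' _ (n + 1), mul_add, mul_sum, smul_sum,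
    add_sub_right_comm, ← sum_sub_distrib]
  congr 1
  · refine sum_congr rfl fun i hi => ?_
    have hin : i ≤ n := Nat.lt_succ_iff.1 (mem_range.1 hi)
    rw [show n + 2 - (i + 1) = n - i + 1 by omega, show n + 1 - (i + 1) = n - i by omega,
      show n + 2 - 2 * (i + 1) = n - 2 * i by omega, Nat.choose_succ_succ, mul_smul_comm,
      smul_smul]
    by_cases h : n - i < i + 1
    · simp only [Nat.choose_eq_zero_of_lt h, add_zero, Nat.cast_zero, mul_zero, zero_mul,
        zero_smul, zero_sub, ← neg_smul]
      congr 1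
      ring
    · rw [← pow_succ', show n + 1 - 2 * (i + 1) + 1 = n - 2 * i by omega, ← sub_smul]
      congr 1
      push_cast
      ring
  · simp [pow_succ']

theorem SimpleGraph.Walk.isNonBacktracking_cons {V : Type*} {G : SimpleGraph V} {u v w : V}
    (h : G.Adj u w) (p : G.Walk w v) :
    (Walk.cons h p).IsNonBacktracking ↔ p.IsNonBacktracking ∧ p.snd ≠ u := by
  constructor
  · intro hp
    refine ⟨fun i hi => ?_, ?_⟩
    · have := hp (i + 1) (by simp only [Walk.length_cons]; omega)
      simpa only [Walk.getVert_cons_succ, add_right_comm i 1 2] using this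
    · cases p with
      | nil => simpa using h.ne'
      | cons h' q => simpa using hp 0 (by simp)
  · rintro ⟨hp, hs⟩ i hi
    cases i with
    | zero => simpa using hs
    | succ i =>
      simp only [add_right_comm i 1 2, Walk.getVert_cons_succ]
      exact hp i (by simp only [Walk.length_cons] at hi; omega)

section

variable {V : Type*} [Fintype V] [DecidableEq V] (G : SimpleGraph V) [DecidableRel G.Adj]

open Classical in
theorem nbWalkCount_eq_card_filter (u v : V) (k : ℕ) :
    nbWalkCount G u v k = #{p ∈ G.finsetWalkLength k u v | p.IsNonBacktracking} := by
  rw [nbWalkCount, ← Nat.card_eq_finsetCard]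
  exact Nat.card_congr (Equiv.subtypeEquivRight fun p => by
    rw [mem_filter, SimpleGraph.mem_finsetWalkLength_iff])

open Classical in
/-- The number of non-backtracking walks of length `k` from `u` to `v` with second vertex `w`. -/
noncomputable def nbWalkCountVia (u w v : V) (k : ℕ) : ℕ :=
  #{p ∈ G.finsetWalkLength k u v | p.IsNonBacktracking ∧ p.snd = w}

theorem nbWalkCount_eq_sum_via (u v : V) (k : ℕ) :
    nbWalkCount G u v k = ∑ w, nbWalkCountVia G u w v k := by
  classical
  rw [nbWalkCount_eq_card_filter,
    card_eq_sum_card_fiberwise (f := fun p => p.snd) (t := univ) (fun _ _ => mem_univ _)]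
  simp only [nbWalkCountVia, filter_filter]

theorem nbWalkCountVia_succ_of_not_adj {u w : V} (h : ¬ G.Adj u w) (v : V) (k : ℕ) :
    nbWalkCountVia G u w v (k + 1) = 0 := by
  classical
  rw [nbWalkCountVia, card_eq_zero, filter_eq_empty_iff]
  rintro p hp ⟨-, rfl⟩
  cases p with
  | nil => simp [SimpleGraph.mem_finsetWalkLength_iff] at hp
  | cons h' q => exact h (by simpa using h')

theorem nbWalkCountVia_succ_add {u w : V} (h : G.Adj u w) (v : V) (k : ℕ) :
    nbWalkCountVia G u w v (k + 1) + nbWalkCountVia G w u v k = nbWalkCount G w v k := by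
  classical
  have key : nbWalkCountVia G u w v (k + 1) =
      #{p ∈ G.finsetWalkLength k w v | p.IsNonBacktracking ∧ ¬ p.snd = u} := by
    symm
    refine card_bij (fun p _ => SimpleGraph.Walk.cons h p) ?_ ?_ ?_
    · intro p hp
      simp only [mem_filter, SimpleGraph.mem_finsetWalkLength_iff] at hp ⊢
      exact ⟨by simp [hp.1], (SimpleGraph.Walk.isNonBacktracking_cons h p).2 hp.2, by simp⟩
    · intro p _ q _ hpq
      simpa using hpq
    · intro p hp
      simp only [mem_filter, SimpleGraph.mem_finsetWalkLength_iff] at hp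
      obtain ⟨hl, hnb, hs⟩ := hp
      cases p with
      | nil => simp at hl
      | cons h' q =>
        obtain rfl : _ = w := by simpa using hs
        refine ⟨q, ?_, rfl⟩
        simp only [mem_filter, SimpleGraph.mem_finsetWalkLength_iff]
        exact ⟨by simpa using hl, (SimpleGraph.Walk.isNonBacktracking_cons h' q).1 hnb⟩
  rw [key, nbWalkCountVia, nbWalkCount_eq_card_filter, add_comm, ← filter_filter,
    ← filter_filter, card_filter_add_card_filter_not]

theorem nbWalkCountVia_zero_of_adj {u w : V} (h : G.Adj u w) (v : V) :
    nbWalkCountVia G u w v 0 = 0 := by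
  classical
  rw [nbWalkCountVia, card_eq_zero, filter_eq_empty_iff]
  rintro p hp ⟨-, hs⟩
  cases p with
  | nil => exact h.ne (by simpa using hs)
  | cons h' q => simp [SimpleGraph.mem_finsetWalkLength_iff] at hp

theorem nbWalkCount_zero (u v : V) : nbWalkCount G u v 0 = if u = v then 1 else 0 := by
  classical
  rw [nbWalkCount_eq_card_filter]
  split_ifs with h
  · subst h
    rw [card_eq_one]
    refine ⟨SimpleGraph.Walk.nil, ?_⟩
    ext p
    simp only [mem_filter, SimpleGraph.mem_finsetWalkLength_iff, mem_singleton,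
      SimpleGraph.Walk.length_eq_zero_iff, ← SimpleGraph.Walk.eq_nil_iff_nil]
    refine ⟨fun hp => hp.1, fun hp => ⟨hp, ?_⟩⟩
    subst hp
    intro i hi
    simp at hi
  · rw [card_eq_zero, filter_eq_empty_iff]
    intro p hp
    exact absurd (SimpleGraph.Walk.eq_of_length_eq_zero
      (SimpleGraph.mem_finsetWalkLength_iff.1 hp)) h

/-- The matrix of non-backtracking walk counts of length `k`. -/
noncomputable def nbWalkMatrix (k : ℕ) : Matrix V V ℤ :=
  Matrix.of fun u v => (nbWalkCount G u v k : ℤ)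

theorem nbWalkMatrix_zero : nbWalkMatrix G 0 = 1 := by
  ext u v
  simp [nbWalkMatrix, nbWalkCount_zero, Matrix.one_apply]

theorem nbWalkCount_succ (u v : V) (k : ℕ) :
    nbWalkCount G u v (k + 1) = ∑ w ∈ G.neighborFinset u, nbWalkCountVia G u w v (k + 1) := by
  rw [nbWalkCount_eq_sum_via]
  refine (sum_subset (subset_univ _) fun w _ hw => ?_).symm
  exact nbWalkCountVia_succ_of_not_adj G (by simpa using hw) v k

theorem nbWalkMatrix_succ_apply (u v : V) (k : ℕ) :
    nbWalkMatrix G (k + 1) u v = (G.adjMatrix ℤ * nbWalkMatrix G k) u v -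
      ∑ w ∈ G.neighborFinset u, (nbWalkCountVia G w u v k : ℤ) := by
  rw [SimpleGraph.adjMatrix_mul_apply, ← sum_sub_distrib]
  simp only [nbWalkMatrix, Matrix.of_apply, nbWalkCount_succ G u v k]
  rw [Nat.cast_sum]
  refine sum_congr rfl fun w hw => ?_
  rw [← nbWalkCountVia_succ_add G ((G.mem_neighborFinset u w).1 hw) v k]
  push_cast
  ring

theorem nbWalkMatrix_one : nbWalkMatrix G 1 = G.adjMatrix ℤ := by
  ext u v
  rw [nbWalkMatrix_succ_apply, nbWalkMatrix_zero, mul_one, sum_eq_zero, sub_zero]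
  intro w hw
  rw [nbWalkCountVia_zero_of_adj G ((G.mem_neighborFinset u w).1 hw).symm, Nat.cast_zero]

variable {G}

theorem sum_nbWalkCountVia_succ {r : ℕ} (hreg : G.IsRegularOfDegree r)
    (u v : V) (k : ℕ) :
    ∑ w ∈ G.neighborFinset u, (nbWalkCountVia G w u v (k + 1) : ℤ) =
      r * nbWalkMatrix G k u v - ∑ w ∈ G.neighborFinset u, (nbWalkCountVia G u w v k : ℤ) := by
  rw [← hreg u, ← G.card_neighborFinset_eq_degree, ← nsmul_eq_mul, ← sum_const,
    ← sum_sub_distrib]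
  refine sum_congr rfl fun w hw => ?_
  rw [nbWalkMatrix, Matrix.of_apply,
    ← nbWalkCountVia_succ_add G ((G.mem_neighborFinset u w).1 hw).symm v k]
  push_cast
  ring

theorem nbWalkMatrix_two {r : ℕ} (hreg : G.IsRegularOfDegree r) :
    nbWalkMatrix G 2 = G.adjMatrix ℤ * G.adjMatrix ℤ - (r : ℤ) • (1 : Matrix V V ℤ) := by
  ext u v
  rw [nbWalkMatrix_succ_apply, nbWalkMatrix_one, sum_nbWalkCountVia_succ hreg,
    nbWalkMatrix_zero, sum_eq_zero]
  · rw [sub_zero, Matrix.sub_apply, Matrix.smul_apply, smul_eq_mul]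
  · intro w hw
    rw [nbWalkCountVia_zero_of_adj G ((G.mem_neighborFinset u w).1 hw), Nat.cast_zero]

theorem nbWalkMatrix_add_three {r : ℕ} (hreg : G.IsRegularOfDegree r) (k : ℕ) :
    nbWalkMatrix G (k + 3) =
      G.adjMatrix ℤ * nbWalkMatrix G (k + 2) - ((r : ℤ) - 1) • nbWalkMatrix G (k + 1) := by
  ext u v
  rw [nbWalkMatrix_succ_apply, sum_nbWalkCountVia_succ hreg, ← Nat.cast_sum,
    ← nbWalkCount_succ]
  simp only [nbWalkMatrix, Matrix.sub_apply, Matrix.smul_apply, Matrix.of_apply, smul_eq_mul]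
  ring

theorem nbWalkMatrix_add_two_eq {r : ℕ} (hreg : G.IsRegularOfDegree r) (k : ℕ) :
    nbWalkMatrix G (k + 2) = chebyshevSum ((r : ℤ) - 1) (G.adjMatrix ℤ) (k + 2) -
      chebyshevSum ((r : ℤ) - 1) (G.adjMatrix ℤ) k := by
  have h0 : chebyshevSum ((r : ℤ) - 1) (G.adjMatrix ℤ) 0 = 1 := by simp [chebyshevSum]
  have h1 : chebyshevSum ((r : ℤ) - 1) (G.adjMatrix ℤ) 1 = G.adjMatrix ℤ := by
    simp [chebyshevSum]
  induction k using Nat.twoStepInduction with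
  | zero =>
    rw [nbWalkMatrix_two hreg, chebyshevSum_add_two, h0, h1, sub_smul, one_smul]
    abel
  | one =>
    rw [nbWalkMatrix_add_three hreg 0, nbWalkMatrix_two hreg, nbWalkMatrix_one,
      chebyshevSum_add_two, chebyshevSum_add_two, h0, h1]
    simp only [mul_sub, sub_smul, mul_smul_comm, mul_one, one_smul]
    abel
  | more k ih1 ih2 =>
    rw [nbWalkMatrix_add_three hreg (k + 1), ih2, ih1, chebyshevSum_add_two _ _ (k + 2),
      chebyshevSum_add_two _ _ k, mul_sub, smul_sub]
    abel

end

/-- Non-backtracking walk counts in a finite `r`-regular graph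
expressed in terms of entries of powers of the adjacency matrix. -/
theorem nbWalkCount_eq_adjMatrix_pow_sum {V : Type*} [Fintype V] [DecidableEq V]
    (G : SimpleGraph V) [DecidableRel G.Adj] (r : ℕ) (hreg : G.IsRegularOfDegree r)
    (n : ℕ) (hn : 1 ≤ n) (u v : V) :
    (nbWalkCount G u v n : ℤ) =
      (∑ i ∈ Finset.range (n / 2 + 1),
        (-1) ^ i * ((n - i).choose i : ℤ) * ((r : ℤ) - 1) ^ i *
          ((G.adjMatrix ℤ) ^ (n - 2 * i)) u v) -
      ∑ i ∈ Finset.range (n / 2),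
        (-1) ^ i * ((n - i - 2).choose i : ℤ) * ((r : ℤ) - 1) ^ i *
          ((G.adjMatrix ℤ) ^ (n - 2 * i - 2)) u v := by
  obtain rfl | ⟨k, rfl⟩ : n = 1 ∨ ∃ k, n = k + 2 := by
    obtain h | h := hn.eq_or_lt
    · exact Or.inl h.symm
    · exact Or.inr ⟨n - 2, by omega⟩
  · simpa [nbWalkMatrix] using congrFun₂ (nbWalkMatrix_one G) u v
  · have h := congrFun₂ (nbWalkMatrix_add_two_eq hreg k) u v
    rw [nbWalkMatrix, Matrix.of_apply, Matrix.sub_apply] at h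
    rw [h, chebyshevSum, chebyshevSum, Matrix.sum_apply, Matrix.sum_apply,
      show (k + 2) / 2 = k / 2 + 1 by omega]
    simp only [Matrix.smul_apply, smul_eq_mul]
    congr 1
    refine sum_congr rfl fun i _ => ?_
    rw [show k + 2 - i - 2 = k - i by omega, show k + 2 - 2 * i - 2 = k - 2 * i by omega]
end

section
/- Let r ≥ 2 be an integer and let x be a real number with |x| < 2√(r−1)/r, so that 4(r−1) − r²x² > 0. Let θ = arccos(rx/(2√(r−1))). Then for every k ≥ 0: p_{r,k}(x) = (r−1)^{−k/2} · ( cos(kθ) + ((r−2)·x / √(4(r−1) − r²x²)) · sin(kθ) ). -/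
/-- The polynomials `p_{r,k}` defined by `p_{r,0} = 1`, `p_{r,1} = X` and
`p_{r,k+2} = (r/(r-1))·X·p_{r,k+1} − (1/(r-1))·p_{r,k}`. -/
noncomputable def nbPoly (r : ℕ) : ℕ → Polynomial ℝ
  | 0 => 1
  | 1 => Polynomial.X
  | (k + 2) =>
      Polynomial.C ((r : ℝ) / ((r : ℝ) - 1)) * (Polynomial.X * nbPoly r (k + 1)) -
        Polynomial.C (1 / ((r : ℝ) - 1)) * nbPoly r k

/-- The two-term recurrence of `nbPoly`, evaluated at a point. -/
theorem nbPoly_eval_add_two (r k : ℕ) (x : ℝ) :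
    (nbPoly r (k + 2)).eval x =
      (r : ℝ) / ((r : ℝ) - 1) * (x * (nbPoly r (k + 1)).eval x) -
        1 / ((r : ℝ) - 1) * (nbPoly r k).eval x := by
  simp [nbPoly]

/-- The functions `k ↦ cos (kθ) + b sin (kθ)` satisfy the Chebyshev recurrence. -/
theorem cos_add_mul_sin_add_two (b θ y : ℝ) :
    Real.cos (y + 2 * θ) + b * Real.sin (y + 2 * θ) =
      2 * Real.cos θ * (Real.cos (y + θ) + b * Real.sin (y + θ)) -
        (Real.cos y + b * Real.sin y) := by
  simp only [Real.cos_add, Real.sin_add, Real.cos_two_mul, Real.sin_two_mul]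
  ring

/-- Closed form for `p_{r,k}(x)` when `|x| < 2√(r−1)/r`:
with `θ = arccos(rx/(2√(r−1)))`,
`p_{r,k}(x) = (r−1)^{−k/2}·(cos(kθ) + ((r−2)x/√(4(r−1)−r²x²))·sin(kθ))`. -/
theorem nbPoly_eval_of_abs_lt (r : ℕ) (hr : 2 ≤ r) (x : ℝ)
    (hx : |x| < 2 * Real.sqrt ((r : ℝ) - 1) / (r : ℝ))
    (θ : ℝ) (hθ : θ = Real.arccos ((r : ℝ) * x / (2 * Real.sqrt ((r : ℝ) - 1)))) :
    0 < 4 * ((r : ℝ) - 1) - (r : ℝ) ^ 2 * x ^ 2 ∧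
    ∀ k : ℕ, (nbPoly r k).eval x =
      ((Real.sqrt ((r : ℝ) - 1))⁻¹) ^ k *
        (Real.cos (k * θ) +
          (((r : ℝ) - 2) * x / Real.sqrt (4 * ((r : ℝ) - 1) - (r : ℝ) ^ 2 * x ^ 2)) *
            Real.sin (k * θ)) := by
  have hr2 : (2 : ℝ) ≤ r := by exact_mod_cast hr
  have hr0 : (0 : ℝ) < r := by linarith
  have hr1 : (0 : ℝ) < (r : ℝ) - 1 := by linarith
  set s := Real.sqrt ((r : ℝ) - 1)
  have hs0 : 0 < s := Real.sqrt_pos.2 hr1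
  have hsq : s ^ 2 = (r : ℝ) - 1 := Real.sq_sqrt hr1.le
  have habs : |(r : ℝ) * x| < 2 * s := by
    rw [abs_mul, abs_of_pos hr0, mul_comm]
    exact (lt_div_iff₀ hr0).1 hx
  have hD : 0 < 4 * ((r : ℝ) - 1) - (r : ℝ) ^ 2 * x ^ 2 := by
    have h := sq_lt_sq' (abs_lt.1 habs).1 (abs_lt.1 habs).2
    nlinarith
  refine ⟨hD, ?_⟩
  set d := Real.sqrt (4 * ((r : ℝ) - 1) - (r : ℝ) ^ 2 * x ^ 2)
  have hd0 : 0 < d := Real.sqrt_pos.2 hD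
  have hdsq : d ^ 2 = 4 * ((r : ℝ) - 1) - (r : ℝ) ^ 2 * x ^ 2 := Real.sq_sqrt hD.le
  have hcos : Real.cos θ = (r : ℝ) * x / (2 * s) := by
    rw [hθ, Real.cos_arccos]
    · rw [le_div_iff₀ (by positivity)]
      linarith [(abs_lt.1 habs).1]
    · rw [div_le_iff₀ (by positivity)]
      linarith [(abs_lt.1 habs).2]
  have hsin : Real.sin θ = d / (2 * s) := by
    rw [hθ, Real.sin_arccos, Real.sqrt_eq_iff_mul_self_eq_of_pos (by positivity)]
    field_simp
    linear_combination hdsq - 4 * hsq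
  intro k
  induction k using Nat.twoStepInduction with
  | zero => simp [nbPoly]
  | one =>
    simp only [nbPoly, Polynomial.eval_X, pow_one, Nat.cast_one, one_mul, hcos, hsin]
    field_simp
    linear_combination 2 * x * hsq
  | more k ih0 ih1 =>
    have h1 : ((k + 1 : ℕ) : ℝ) * θ = k * θ + θ := by push_cast; ring
    have h2 : ((k + 2 : ℕ) : ℝ) * θ = k * θ + 2 * θ := by push_cast; ring
    have hrx : (r : ℝ) * x = 2 * s * Real.cos θ := by
      rw [hcos]
      field_simp
    rw [nbPoly_eval_add_two, ih0, ih1, h1, h2, cos_add_mul_sin_add_two, ← mul_assoc,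
      div_mul_eq_mul_div, hrx, ← hsq]
    generalize Real.cos (k * θ + θ) + _ = A
    generalize Real.cos (k * θ) + _ = B
    simp only [inv_pow]
    field_simp
    ring
end

section
/- Let r ≥ 2 be an integer and let λ be a real number with 2√(r−1)/r < |λ| ≤ 1. Then for every k ≥ 0: |p_{r,k}(λ)| ≤ |λ|^k. -/
/-- `p_{r,k}` has the parity of `k`. -/
theorem nbPoly_eval_neg (r : ℕ) (x : ℝ) (k : ℕ) :
    (nbPoly r k).eval (-x) = (-1) ^ k * (nbPoly r k).eval x := by
  induction k using Nat.twoStepInduction with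
  | zero => simp [nbPoly]
  | one => simp [nbPoly]
  | more k ih0 ih1 =>
    rw [nbPoly_eval_add_two, nbPoly_eval_add_two, ih0, ih1]
    ring

theorem abs_nbPoly_eval_abs (r : ℕ) (x : ℝ) (k : ℕ) :
    |(nbPoly r k).eval (|x|)| = |(nbPoly r k).eval x| := by
  rcases abs_choice x with h | h <;> rw [h]
  rw [nbPoly_eval_neg, abs_mul, abs_pow, abs_neg, abs_one, one_pow, one_mul]

/-- Outside the bulk, the ratio of consecutive values lies between `r x / (2 (r - 1))` and `x`. -/
theorem nbPoly_eval_succ_bounds {r : ℕ} (hr : 2 ≤ r) {x : ℝ} (hx0 : 0 ≤ x) (hx1 : x ≤ 1)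
    (hx : 4 * ((r : ℝ) - 1) ≤ (r * x) ^ 2) (k : ℕ) :
    0 ≤ (nbPoly r k).eval x ∧
      r * x * (nbPoly r k).eval x ≤ 2 * ((r : ℝ) - 1) * (nbPoly r (k + 1)).eval x ∧
      (nbPoly r (k + 1)).eval x ≤ x * (nbPoly r k).eval x := by
  have hr' : (2 : ℝ) ≤ r := by exact_mod_cast hr
  have hd : (0 : ℝ) < r - 1 := by linarith
  induction k with
  | zero =>
    simp only [nbPoly, Polynomial.eval_one, Polynomial.eval_X]
    exact ⟨zero_le_one, by nlinarith, by linarith⟩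
  | succ k ih =>
    obtain ⟨hp, hlow, hup⟩ := ih
    have hrec : ((r : ℝ) - 1) * (nbPoly r (k + 2)).eval x =
        r * x * (nbPoly r (k + 1)).eval x - (nbPoly r k).eval x := by
      rw [nbPoly_eval_add_two]
      field_simp
    have hrx : 0 ≤ (r : ℝ) * x := by positivity
    generalize (nbPoly r k).eval x = a at *
    generalize (nbPoly r (k + 1)).eval x = b at *
    generalize (nbPoly r (k + 2)).eval x = c at *
    have hb : 0 ≤ b := by
      have : 0 ≤ 2 * ((r : ℝ) - 1) * b := (mul_nonneg hrx hp).trans hlow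
      exact nonneg_of_mul_nonneg_right this (by linarith)
    refine ⟨hb, ?_, ?_⟩
    · have h : 2 * ((r : ℝ) - 1) * (2 * a) ≤ 2 * ((r : ℝ) - 1) * (r * x * b) := by
        linarith [mul_le_mul_of_nonneg_left hlow hrx, mul_le_mul_of_nonneg_right hx hp]
      linarith [le_of_mul_le_mul_left h (by linarith)]
    · have hxb : x * b ≤ a :=
        calc x * b ≤ 1 * b := by gcongr
          _ ≤ x * a := by linarith
          _ ≤ 1 * a := by gcongr
          _ = a := one_mul a
      refine le_of_mul_le_mul_left ?_ hd
      linarith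

/-- For `2√(r−1)/r < |λ| ≤ 1` one has `|p_{r,k}(λ)| ≤ |λ|^k`. -/
theorem abs_nbPoly_eval_le_of_abs_gt (r : ℕ) (hr : 2 ≤ r) (lam : ℝ)
    (h1 : 2 * Real.sqrt ((r : ℝ) - 1) / (r : ℝ) < |lam|) (h2 : |lam| ≤ 1)
    (k : ℕ) :
    |(nbPoly r k).eval lam| ≤ |lam| ^ k := by
  have hr' : (2 : ℝ) ≤ r := by exact_mod_cast hr
  have hx : 4 * ((r : ℝ) - 1) ≤ (r * |lam|) ^ 2 := by
    rw [div_lt_iff₀ (by linarith)] at h1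
    calc 4 * ((r : ℝ) - 1) = (2 * √((r : ℝ) - 1)) ^ 2 := by
          rw [mul_pow, Real.sq_sqrt (by linarith)]; norm_num
      _ ≤ (r * |lam|) ^ 2 := by
          rw [mul_comm (r : ℝ)]
          gcongr
  have hbounds := nbPoly_eval_succ_bounds hr (abs_nonneg lam) h2 hx
  rw [← abs_nbPoly_eval_abs, abs_of_nonneg (hbounds k).1]
  induction k with
  | zero => simp [nbPoly]
  | succ k ih =>
    rw [pow_succ']
    exact (hbounds k).2.2.trans (mul_le_mul_of_nonneg_left ih (abs_nonneg lam))
end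

section
/- For every integer r ≥ 2 there exists a constant C > 0, depending only on r, such that for every real number λ with |λ| ≤ 2√(r−1)/r and every integer k ≥ 1: |p_{r,k}(λ)| ≤ C · k · (r−1)^{−k/2}. -/
open Polynomial in
theorem abs_eval_chebyshev_U_le (n : ℕ) {x : ℝ} (hx : |x| ≤ 1) :
    |(Chebyshev.U ℝ n).eval x| ≤ n + 1 := by
  induction n with
  | zero => simp
  | succ n ih =>
    push_cast
    rw [Chebyshev.U_eq_X_mul_U_add_T, eval_add, eval_mul, eval_X]
    calc |x * (Chebyshev.U ℝ n).eval x + (Chebyshev.T ℝ (n + 1)).eval x|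
        ≤ |x| * |(Chebyshev.U ℝ n).eval x| + |(Chebyshev.T ℝ (n + 1)).eval x| := by
          rw [← abs_mul]
          exact abs_add_le _ _
      _ ≤ 1 * (n + 1) + 1 := by
          gcongr
          exact Chebyshev.abs_eval_T_real_le_one _ hx
      _ = n + 1 + 1 := by ring

open Polynomial in
theorem pow_mul_nbPoly_eval_eq_chebyshev (r : ℕ) (hr : (r : ℝ) ≠ 0) {s : ℝ} (hs : s ≠ 0)
    (hsr : s ^ 2 = (r : ℝ) - 1) (x : ℝ) (k : ℕ) :
    s ^ k * (nbPoly r k).eval (2 * s * x / r) =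
      (Chebyshev.T ℝ k).eval x +
        ((r : ℝ) - 2) / r * x * (Chebyshev.U ℝ ((k : ℤ) - 1)).eval x := by
  induction k using Nat.twoStepInduction with
  | zero => simp [nbPoly]
  | one =>
    simp only [nbPoly, eval_X, Nat.cast_one, Chebyshev.T_one, sub_self, Chebyshev.U_zero, eval_one]
    field_simp
    linear_combination 2 * x * hsr
  | more k ih₀ ih₁ =>
    have hU : Chebyshev.U ℝ (((k + 2 : ℕ) : ℤ) - 1) =
        2 * X * Chebyshev.U ℝ (((k + 1 : ℕ) : ℤ) - 1) - Chebyshev.U ℝ ((k : ℤ) - 1) := by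
      convert Chebyshev.U_add_two ℝ ((k : ℤ) - 1) using 3 <;> (push_cast; ring_nf)
    have hT : Chebyshev.T ℝ ((k + 2 : ℕ) : ℤ) =
        2 * X * Chebyshev.T ℝ ((k + 1 : ℕ) : ℤ) - Chebyshev.T ℝ k := by
      exact_mod_cast Chebyshev.T_add_two ℝ k
    have hrec : s ^ (k + 2) * (nbPoly r (k + 2)).eval (2 * s * x / r) =
        2 * x * (s ^ (k + 1) * (nbPoly r (k + 1)).eval (2 * s * x / r)) -
          s ^ k * (nbPoly r k).eval (2 * s * x / r) := by
      simp only [nbPoly, eval_sub, eval_mul, eval_C, eval_X, ← hsr]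
      field_simp
      ring
    rw [hrec, ih₀, ih₁, hU, hT]
    simp only [eval_sub, eval_mul, eval_X, eval_ofNat]
    ring

/-- For `|λ| ≤ 2√(r−1)/r` one has `|p_{r,k}(λ)| ≤ C·k·(r−1)^{−k/2}`
for a constant `C > 0` depending only on `r`. -/
theorem abs_nbPoly_eval_le_of_abs_le (r : ℕ) (hr : 2 ≤ r) :
    ∃ C : ℝ, 0 < C ∧
      ∀ lam : ℝ, |lam| ≤ 2 * Real.sqrt ((r : ℝ) - 1) / (r : ℝ) →
        ∀ k : ℕ, 1 ≤ k →
          |(nbPoly r k).eval lam| ≤ C * k * ((Real.sqrt ((r : ℝ) - 1))⁻¹) ^ k := by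
  have hr2 : (2 : ℝ) ≤ r := by exact_mod_cast hr
  have hr0 : (0 : ℝ) < r := by linarith
  refine ⟨2, two_pos, fun lam hlam k hk => ?_⟩
  have hsr : Real.sqrt ((r : ℝ) - 1) ^ 2 = (r : ℝ) - 1 := Real.sq_sqrt (by linarith)
  have hs : 0 < Real.sqrt ((r : ℝ) - 1) := Real.sqrt_pos.mpr (by linarith)
  set s := Real.sqrt ((r : ℝ) - 1)
  obtain ⟨x, rfl⟩ : ∃ x, lam = 2 * s * x / r := ⟨r * lam / (2 * s), by field_simp⟩
  have hx : |x| ≤ 1 := by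
    rw [abs_div, abs_mul, abs_of_pos (by positivity : 0 < 2 * s), abs_of_pos hr0,
      div_le_div_iff_of_pos_right hr0] at hlam
    exact le_of_mul_le_mul_left (by linarith) (by positivity : 0 < 2 * s)
  have hT := Polynomial.Chebyshev.abs_eval_T_real_le_one k hx
  have hU : |(Polynomial.Chebyshev.U ℝ ((k : ℤ) - 1)).eval x| ≤ k := by
    obtain ⟨n, rfl⟩ := Nat.exists_eq_add_of_le' hk
    simpa using abs_eval_chebyshev_U_le n hx
  have hc : |((r : ℝ) - 2) / r| ≤ 1 := by
    rw [abs_of_nonneg (div_nonneg (by linarith) hr0.le), div_le_one hr0]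
    linarith
  have hk1 : (1 : ℝ) ≤ k := by exact_mod_cast hk
  rw [inv_pow, ← div_eq_mul_inv, le_div_iff₀ (by positivity), mul_comm,
    ← abs_of_pos (pow_pos hs k), ← abs_mul,
    pow_mul_nbPoly_eval_eq_chebyshev r hr0.ne' hs.ne' hsr]
  calc _ ≤ |(Polynomial.Chebyshev.T ℝ k).eval x| +
        |((r : ℝ) - 2) / r| * |x| * |(Polynomial.Chebyshev.U ℝ ((k : ℤ) - 1)).eval x| := by
        rw [← abs_mul, ← abs_mul]
        exact abs_add_le _ _
    _ ≤ 1 + 1 * 1 * k := by gcongr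
    _ ≤ 2 * k := by linarith
end

section
/- For every n ≥ 0: T_n² = Σ_{k=0}^{n} C(n+k, 2k) · C(2k, k)² · (−3)^{n−k}, where T_n is the central trinomial coefficient and C(a,b) denotes the binomial coefficient. -/
/-- The central trinomial coefficient: the coefficient of `x^n` in `(1 + x + x²)^n`. -/
noncomputable def centralTrinomial (n : ℕ) : ℤ :=
  ((1 + Polynomial.X + Polynomial.X ^ 2 : Polynomial ℤ) ^ n).coeff n

open Polynomial in
theorem coeff_trinomial_mul {R : Type*} [CommRing R] (q : R[X]) (m : ℕ) :
    ((1 + X + X ^ 2) * q).coeff (m + 2) = q.coeff (m + 2) + q.coeff (m + 1) + q.coeff m := by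
  have h : (1 + X + X ^ 2) * q = q + X * q + X * (X * q) := by ring
  rw [h]
  simp only [coeff_add, coeff_X_mul]

open Polynomial in
theorem coeff_trinomial_pow_succ {R : Type*} [CommRing R] (n m : ℕ) :
    ((1 + X + X ^ 2 : R[X]) ^ (n + 1)).coeff (m + 2) =
      ((1 + X + X ^ 2 : R[X]) ^ n).coeff (m + 2) + ((1 + X + X ^ 2 : R[X]) ^ n).coeff (m + 1) +
        ((1 + X + X ^ 2 : R[X]) ^ n).coeff m := by
  rw [pow_succ', coeff_trinomial_mul]

/-- The coefficient recurrence coming from `p * (p ^ n)' = n * p' * p ^ n`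
with `p = 1 + x + x²`. -/
theorem coeff_trinomial_pow_recurrence {R : Type*} [CommRing R] (n m : ℕ) :
    ((m : R) + 2) * ((1 + .X + .X ^ 2 : Polynomial R) ^ n).coeff (m + 2) =
      (n - (m + 1)) * ((1 + .X + .X ^ 2 : Polynomial R) ^ n).coeff (m + 1) +
        (2 * n - m) * ((1 + .X + .X ^ 2 : Polynomial R) ^ n).coeff m := by
  open Polynomial in
  have h : X * ((1 + X + X ^ 2) * derivative ((1 + X + X ^ 2 : R[X]) ^ n)) =
      C (n : R) * (X * ((1 + X + X ^ 2) ^ n) + X * (X * (2 * (1 + X + X ^ 2) ^ n))) := by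
    rcases n with _ | n
    · simp
    · rw [derivative_pow_succ]
      simp
      ring
  have h₂ : X * ((1 + X + X ^ 2) * derivative ((1 + X + X ^ 2 : R[X]) ^ n)) =
      (1 + X + X ^ 2) * (X * derivative ((1 + X + X ^ 2 : R[X]) ^ n)) := by ring
  rw [h₂] at h
  have hc := congrArg (fun q => q.coeff (m + 2)) h
  rcases m with _ | m
  · simp [coeff_trinomial_mul, coeff_X_mul, coeff_derivative, coeff_ofNat_mul] at hc
    push_cast
    linear_combination hc
  · simp [coeff_trinomial_mul, coeff_X_mul, coeff_derivative, coeff_ofNat_mul] at hc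
    push_cast
    linear_combination hc

theorem centralTrinomial_succ (n : ℕ) :
    centralTrinomial (n + 1) = centralTrinomial n +
      2 * ((1 + .X + .X ^ 2 : Polynomial ℤ) ^ n).coeff (n + 1) := by
  rcases n with _ | n
  · simp [centralTrinomial, Polynomial.coeff_one, Polynomial.coeff_X]
  · have h := coeff_trinomial_pow_recurrence (R := ℤ) (n + 1) n
    push_cast at h
    have hu : ((1 + .X + .X ^ 2 : Polynomial ℤ) ^ (n + 1)).coeff (n + 2) =
        ((1 + .X + .X ^ 2 : Polynomial ℤ) ^ (n + 1)).coeff n :=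
      mul_left_cancel₀ (show (n : ℤ) + 2 ≠ 0 by positivity) (by linear_combination h)
    simp only [centralTrinomial]
    rw [coeff_trinomial_pow_succ (n + 1) n, ← hu]
    ring

theorem centralTrinomial_recurrence (n : ℕ) :
    ((n : ℤ) + 2) * centralTrinomial (n + 2) =
      (2 * n + 3) * centralTrinomial (n + 1) + 3 * (n + 1) * centralTrinomial n := by
  have h₁ := centralTrinomial_succ n
  have h₂ := centralTrinomial_succ (n + 1)
  have h₃ := coeff_trinomial_pow_succ (R := ℤ) n n
  have h₄ := coeff_trinomial_pow_recurrence (R := ℤ) n n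
  have h₅ : ((1 + .X + .X ^ 2 : Polynomial ℤ) ^ n).coeff n = centralTrinomial n := rfl
  rw [h₅] at h₃ h₄
  linear_combination (n + 2 : ℤ) * h₂ + 2 * (n + 2 : ℤ) * h₃ + 2 * h₄ - (n + 1 : ℤ) * h₁

theorem cast_succ_mul_choose {R : Type*} [CommRing R] (n k : ℕ) :
    ((n : R) + 1) * n.choose k = (n + 1 - k) * (n + 1).choose k := by
  rcases le_or_gt k (n + 1) with hk | hk
  · have h := congrArg (Nat.cast (R := R)) (Nat.choose_mul_succ_eq n k)
    push_cast [Nat.cast_sub hk] at h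
    linear_combination h
  · simp [Nat.choose_eq_zero_of_lt hk, Nat.choose_eq_zero_of_lt (show n < k by omega)]

theorem cast_succ_mul_choose_succ {R : Type*} [CommRing R] (n k : ℕ) :
    ((k : R) + 1) * n.choose (k + 1) = (n - k) * n.choose k := by
  have h := cast_succ_mul_choose (R := R) n (k + 1)
  rw [Nat.choose_succ_succ] at h
  push_cast at h
  linear_combination h

/-- The summand `C(n+k, 2k) C(2k, k)² (-3)^(n-k)`, as a rational number for all `n` and `k`. -/
def trinomialSqTerm (n k : ℕ) : ℚ :=
  (n + k).choose (2 * k) * ((2 * k).choose k) ^ 2 * (-3) ^ n * (-1 / 3) ^ k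

theorem trinomialSqTerm_eq_zero {n k : ℕ} (h : n < k) : trinomialSqTerm n k = 0 := by
  simp [trinomialSqTerm, Nat.choose_eq_zero_of_lt (show n + k < 2 * k by omega)]

theorem sub_mul_trinomialSqTerm_succ (n k : ℕ) :
    ((k : ℚ) - (n + 1)) * trinomialSqTerm (n + 1) k = 3 * (n + 1 + k) * trinomialSqTerm n k := by
  have h := cast_succ_mul_choose (R := ℚ) (n + k) (2 * k)
  push_cast at h
  simp only [trinomialSqTerm, show n + 1 + k = n + k + 1 by ring, pow_succ]
  linear_combination (-3) * (((2 * k).choose k : ℚ) ^ 2 * (-3) ^ n * (-1 / 3) ^ k) * h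

/-- A sum rule for the combination of summands annihilated by the recurrence of the squares. -/
theorem sum_trinomialSqTerm_combination (n m : ℕ) :
    ∑ k ∈ Finset.range (m + 1),
      (((n : ℚ) + 2) ^ 2 * trinomialSqTerm (n + 2) k -
        (2 * n + 3) ^ 2 * trinomialSqTerm (n + 1) k -
        2 * (2 * n + 3) * ((k - (n + 1)) * trinomialSqTerm (n + 1) k) -
        9 * (n + 1) ^ 2 * trinomialSqTerm n k) =
      -4 * (2 * n + 3) * (2 * m + 1) * trinomialSqTerm (n + 1) m := by
  induction m with
  | zero =>
    simp [trinomialSqTerm]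
    ring
  | succ m ih =>
    rw [Finset.sum_range_succ, ih]
    have hq := cast_succ_mul_choose_succ (R := ℚ) (n + 1 + m) (2 * m)
    have hr := cast_succ_mul_choose_succ (R := ℚ) (n + 1 + m) (2 * m + 1)
    have hb : ((m : ℚ) + 1) * (2 * (m + 1)).choose (m + 1) =
        2 * (2 * m + 1) * (2 * m).choose m := by
      exact_mod_cast Nat.succ_mul_centralBinom_succ m
    simp only [trinomialSqTerm]
    rw [show n + 2 + (m + 1) = n + 1 + m + 1 + 1 by ring,
      show n + 1 + (m + 1) = n + 1 + m + 1 by ring, show n + (m + 1) = n + 1 + m by ring,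
      show 2 * (m + 1) = 2 * m + 1 + 1 by ring] at *
    rw [Nat.choose_succ_succ (n + 1 + m + 1), Nat.choose_succ_succ (n + 1 + m) (2 * m + 1),
      Nat.choose_succ_succ (n + 1 + m) (2 * m)]
    push_cast at hq hr hb ⊢
    have hq₂ := eq_div_of_mul_eq (by positivity) ((mul_comm _ _).trans hq)
    have hr₂ := eq_div_of_mul_eq (by positivity) ((mul_comm _ _).trans hr)
    have hb₂ := eq_div_of_mul_eq (by positivity) ((mul_comm _ _).trans hb)
    rw [hr₂, hq₂, hb₂, pow_succ (-1 / 3 : ℚ), pow_succ (-3 : ℚ) (n + 1), pow_succ (-3 : ℚ) n]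
    field_simp
    ring

/-- The sum of `trinomialSqTerm n k` over all `k`. -/
def trinomialSqSum (n : ℕ) : ℚ := ∑ k ∈ Finset.range (n + 1), trinomialSqTerm n k

/-- The sum representing `n * T_n * T_(n-1)`. -/
def trinomialMulSum (n : ℕ) : ℚ :=
  ∑ k ∈ Finset.range (n + 1), ((k : ℚ) - n) / 3 * trinomialSqTerm n k

theorem sum_range_mul_trinomialSqTerm (c : ℕ → ℚ) {n m : ℕ} (h : n + 1 ≤ m) :
    ∑ k ∈ Finset.range (n + 1), c k * trinomialSqTerm n k =
      ∑ k ∈ Finset.range m, c k * trinomialSqTerm n k := by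
  refine Finset.sum_subset (Finset.range_mono h) fun k _ hk => ?_
  rw [trinomialSqTerm_eq_zero (by simpa using hk), mul_zero]

theorem trinomialSqSum_eq {n m : ℕ} (h : n + 1 ≤ m) :
    trinomialSqSum n = ∑ k ∈ Finset.range m, trinomialSqTerm n k := by
  simpa [trinomialSqSum] using sum_range_mul_trinomialSqTerm (fun _ => 1) h

theorem trinomialMulSum_eq {n m : ℕ} (h : n + 1 ≤ m) :
    trinomialMulSum n = ∑ k ∈ Finset.range m, ((k : ℚ) - n) / 3 * trinomialSqTerm n k :=
  sum_range_mul_trinomialSqTerm _ h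

theorem trinomialMulSum_succ (n : ℕ) :
    trinomialMulSum (n + 1) = (2 * n + 1) * trinomialSqSum n + 3 * trinomialMulSum n := by
  rw [trinomialSqSum_eq (n.succ.le_succ), trinomialMulSum_eq (n.succ.le_succ), trinomialMulSum,
    Finset.mul_sum, Finset.mul_sum, ← Finset.sum_add_distrib]
  refine Finset.sum_congr rfl fun k _ => ?_
  push_cast
  linear_combination sub_mul_trinomialSqTerm_succ n k / 3

theorem trinomialSqSum_recurrence (n : ℕ) :
    ((n : ℚ) + 2) ^ 2 * trinomialSqSum (n + 2) =
      (2 * n + 3) ^ 2 * trinomialSqSum (n + 1) + 6 * (2 * n + 3) * trinomialMulSum (n + 1) +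
        9 * (n + 1) ^ 2 * trinomialSqSum n := by
  have h := sum_trinomialSqTerm_combination n (n + 2)
  rw [trinomialSqTerm_eq_zero (show n + 1 < n + 2 by omega), mul_zero] at h
  rw [trinomialSqSum_eq (n := n + 2) (m := n + 2 + 1) (by omega),
    trinomialSqSum_eq (n := n + 1) (m := n + 2 + 1) (by omega),
    trinomialMulSum_eq (n := n + 1) (m := n + 2 + 1) (by omega),
    trinomialSqSum_eq (n := n) (m := n + 2 + 1) (by omega), ← sub_eq_zero, ← h]
  simp only [Finset.mul_sum, ← Finset.sum_add_distrib, ← Finset.sum_sub_distrib]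
  refine Finset.sum_congr rfl fun k _ => ?_
  push_cast
  ring

theorem centralTrinomial_sq_and_mul (n : ℕ) :
    (centralTrinomial n : ℚ) ^ 2 = trinomialSqSum n ∧
      (centralTrinomial (n + 1) : ℚ) ^ 2 = trinomialSqSum (n + 1) ∧
      ((n : ℚ) + 1) * (centralTrinomial (n + 1) * centralTrinomial n) =
        trinomialMulSum (n + 1) := by
  induction n with
  | zero =>
    have h₀ : centralTrinomial 0 = 1 := by simp [centralTrinomial]
    have h₁ : centralTrinomial 1 = 1 := by
      simp [centralTrinomial, Polynomial.coeff_one, Polynomial.coeff_X]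
    simp [h₀, h₁, trinomialSqSum, trinomialMulSum, trinomialSqTerm, Finset.sum_range_succ]
    norm_num
  | succ n ih =>
    obtain ⟨ih₀, ih₁, ih₂⟩ := ih
    have hT := congrArg (Int.cast (R := ℚ)) (centralTrinomial_recurrence n)
    have hS := trinomialSqSum_recurrence n
    have hW := trinomialMulSum_succ (n + 1)
    rw [← ih₀, ← ih₁, ← ih₂] at hS
    rw [← ih₁, ← ih₂] at hW
    push_cast at hT hW ⊢
    refine ⟨ih₁, ?_, ?_⟩
    · refine mul_left_cancel₀ (show ((n : ℚ) + 2) ^ 2 ≠ 0 by positivity) ?_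
      rw [hS, ← mul_pow, hT]
      ring
    · rw [hW]
      linear_combination (centralTrinomial (n + 1) : ℚ) * hT

/-- Sun's identity:
`T_n² = ∑_{k=0}^n C(n+k, 2k)·C(2k, k)²·(−3)^{n−k}`. -/
theorem centralTrinomial_sq_eq_sum (n : ℕ) :
    (centralTrinomial n) ^ 2 =
      ∑ k ∈ Finset.range (n + 1),
        ((n + k).choose (2 * k) : ℤ) * (((2 * k).choose k : ℤ)) ^ 2 * (-3 : ℤ) ^ (n - k) := by
  have h := (centralTrinomial_sq_and_mul n).1
  rw [← Int.cast_inj (α := ℚ)]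
  push_cast
  rw [h, trinomialSqSum]
  refine Finset.sum_congr rfl fun k hk => ?_
  obtain ⟨m, rfl⟩ := Nat.exists_eq_add_of_le (Finset.mem_range_succ_iff.mp hk)
  have h₃ : (-3 : ℚ) ^ k * (-1 / 3) ^ k = 1 := by rw [← mul_pow]; norm_num
  rw [trinomialSqTerm, Nat.add_sub_cancel_left, pow_add]
  linear_combination ((k + m + k).choose (2 * k) : ℚ) * ((2 * k).choose k) ^ 2 * (-3) ^ m * h₃
end

section
/- The central trinomial coefficients satisfy the asymptotic T_n ~ (√3 / (2√(πn))) · 3^n as n → ∞; that is, the ratio T_n · 2√(πn) / (√3 · 3^n) tends to 1 as n → ∞. -/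
open Real Filter Topology MeasureTheory Set

/-- The normalised symbol `(1 + 2 cos θ) / 3` of the trinomial walk. -/
noncomputable def trinomialSymbol (θ : ℝ) : ℝ := (1 + 2 * cos θ) / 3

lemma continuous_trinomialSymbol : Continuous trinomialSymbol := by
  unfold trinomialSymbol
  fun_prop

/-- The integral representation of the central trinomial coefficients. -/
lemma centralTrinomial_eq_integral (n : ℕ) :
    (centralTrinomial n : ℝ) = (1 / (2 * π)) * ∫ θ in -π..π, (1 + 2 * cos θ) ^ n := by
  have : Fact (0 < 2 * π) := ⟨two_pi_pos⟩
  have hcoeff := Polynomial.fourierCoeff_toAddCircle_natCast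
    ((1 + Polynomial.X + Polynomial.X ^ 2 : Polynomial ℂ) ^ n) n
  have hmap : (1 + Polynomial.X + Polynomial.X ^ 2 : Polynomial ℂ) ^ n =
      ((1 + Polynomial.X + Polynomial.X ^ 2 : Polynomial ℤ) ^ n).map (Int.castRingHom ℂ) := by
    simp
  have hintegrand (θ : ℝ) : fourier (-(n : ℤ)) (θ : AddCircle (2 * π)) •
      Polynomial.toAddCircle ((1 + Polynomial.X + Polynomial.X ^ 2) ^ n)
        (θ : AddCircle (2 * π)) = (((1 + 2 * cos θ) ^ n : ℝ) : ℂ) := by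
    have hpi : (π : ℂ) ≠ 0 := by exact_mod_cast pi_ne_zero
    rw [map_pow, map_add, map_add, map_one, map_pow, Polynomial.toAddCircle_X_eq_fourier_one]
    have hneg : fourier (-(n : ℤ)) (θ : AddCircle (2 * π)) =
        Complex.exp (-(θ * Complex.I)) ^ n := by
      rw [fourier_coe_apply, ← Complex.exp_nat_mul]
      congr 1
      push_cast
      field_simp
    have hone : fourier 1 (θ : AddCircle (2 * π)) = Complex.exp (θ * Complex.I) := by
      rw [fourier_coe_apply]
      congr 1
      push_cast
      field_simp
    simp only [ContinuousMap.pow_apply, ContinuousMap.add_apply, ContinuousMap.one_apply,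
      smul_eq_mul]
    rw [hneg, hone, ← mul_pow]
    push_cast
    rw [Complex.two_cos]
    congr 1
    have hmul : Complex.exp (-(θ * Complex.I)) * Complex.exp (θ * Complex.I) = 1 := by
      rw [← Complex.exp_add]
      simp
    rw [neg_mul]
    linear_combination (1 + Complex.exp (θ * Complex.I)) * hmul
  rw [fourierCoeff_eq_intervalIntegral _ _ (-π), show -π + 2 * π = π by ring] at hcoeff
  simp_rw [hintegrand] at hcoeff
  rw [intervalIntegral.integral_ofReal, hmap, Polynomial.coeff_map] at hcoeff
  rw [centralTrinomial]
  apply Complex.ofReal_injective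
  rw [Complex.real_smul] at hcoeff
  simpa using hcoeff.symm

lemma abs_trinomialSymbol_le_exp {θ : ℝ} (hθ : |θ| ≤ π) :
    |trinomialSymbol θ| ≤ exp (-(2 / (3 * π ^ 2)) * θ ^ 2) := by
  have hsq : θ ^ 2 ≤ π ^ 2 := sq_le_sq' (abs_le.1 hθ).1 (abs_le.1 hθ).2
  have hpi : 0 < π ^ 2 := by positivity
  have hratio : θ ^ 2 / π ^ 2 ≤ 1 := (div_le_one hpi).2 hsq
  have hratio₀ : 0 ≤ θ ^ 2 / π ^ 2 := by positivity
  have hcos := cos_le_one_sub_mul_cos_sq hθ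
  rw [show 2 / π ^ 2 * θ ^ 2 = 2 * (θ ^ 2 / π ^ 2) by ring] at hcos
  rw [show -(2 / (3 * π ^ 2)) * θ ^ 2 = -(2 / 3) * (θ ^ 2 / π ^ 2) by field_simp]
  refine le_trans ?_ (add_one_le_exp _)
  unfold trinomialSymbol
  rw [abs_le]
  constructor <;> linarith [neg_one_le_cos θ]

lemma tendsto_trinomialSymbol_pow (t : ℝ) :
    Tendsto (fun n : ℕ => trinomialSymbol (t / √n) ^ n) atTop (𝓝 (exp (-(1 / 3) * t ^ 2))) := by
  have hzero : Tendsto (fun n : ℕ => t / √(n : ℝ) / 2) atTop (𝓝 0) := by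
    have h := (tendsto_sqrt_atTop.comp tendsto_natCast_atTop_atTop).const_div_atTop t
    simpa using h.div_const 2
  have hsinc : Tendsto (fun n : ℕ => -(1 / 3) * t ^ 2 * sinc (t / √(n : ℝ) / 2) ^ 2) atTop
      (𝓝 (-(1 / 3) * t ^ 2)) := by
    have h := (((continuous_sinc.tendsto 0).comp hzero).pow 2).const_mul (-(1 / 3) * t ^ 2)
    rwa [sinc_zero, one_pow, mul_one] at h
  have hlim := tendsto_one_add_pow_exp_of_tendsto
    (g := fun n : ℕ => -(4 / 3) * sin (t / √(n : ℝ) / 2) ^ 2) (hsinc.congr' ?_)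
  · refine hlim.congr fun n => ?_
    congr 1
    have hcos := cos_sq_add_sin_sq (t / √(n : ℝ) / 2)
    have htwo := cos_two_mul (t / √(n : ℝ) / 2)
    rw [show 2 * (t / √(n : ℝ) / 2) = t / √(n : ℝ) by ring] at htwo
    unfold trinomialSymbol
    linarith
  · filter_upwards [eventually_gt_atTop 0] with n hn
    have hn' : (0 : ℝ) < n := by exact_mod_cast hn
    have hsin (y : ℝ) : sin y = y * sinc y := by
      rcases eq_or_ne y 0 with rfl | hy
      · simp
      · rw [sinc_of_ne_zero hy]
        field_simp
    rw [hsin, mul_pow, div_pow, div_pow, sq_sqrt hn'.le]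
    field_simp
    ring

lemma tendsto_integral_trinomialSymbol_pow :
    Tendsto (fun n : ℕ => ∫ t in -(π * √n)..π * √n, trinomialSymbol (t / √n) ^ n) atTop
      (𝓝 √(3 * π)) := by
  have hgauss : ∫ t : ℝ, exp (-(1 / 3) * t ^ 2) = √(3 * π) := by
    rw [integral_gaussian]
    congr 1
    ring
  rw [← hgauss]
  have hmeas (n : ℕ) : MeasurableSet (Ioc (-(π * √(n : ℝ))) (π * √n)) := measurableSet_Ioc
  have heq (n : ℕ) : ∫ t in -(π * √n)..π * √n, trinomialSymbol (t / √n) ^ n =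
      ∫ t, (Ioc (-(π * √n)) (π * √n)).indicator
        (fun t => trinomialSymbol (t / √n) ^ n) t := by
    rw [intervalIntegral.integral_of_le (neg_le_self (by positivity)),
      integral_indicator (hmeas n)]
  simp_rw [heq]
  refine tendsto_integral_of_dominated_convergence
    (fun t => exp (-(2 / (3 * π ^ 2)) * t ^ 2)) (fun n => ?_)
    (integrable_exp_neg_mul_sq (by positivity)) (fun n => ?_) ?_
  · have hcont : Continuous fun t : ℝ => trinomialSymbol (t / √n) ^ n :=
      (continuous_trinomialSymbol.comp (continuous_id.div_const _)).pow n
    exact hcont.aestronglyMeasurable.indicator (hmeas n)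
  · refine Eventually.of_forall fun t => ?_
    by_cases ht : t ∈ Ioc (-(π * √(n : ℝ))) (π * √n)
    · have hn : 0 < √(n : ℝ) := by
        have h := ht.1.trans_le ht.2
        nlinarith [pi_pos, sqrt_nonneg (n : ℝ)]
      have habs : |t / √(n : ℝ)| ≤ π := by
        rw [abs_div, abs_of_pos hn, div_le_iff₀ hn]
        exact abs_le.2 ⟨ht.1.le, ht.2⟩
      rw [indicator_of_mem ht, norm_pow, norm_eq_abs]
      refine (pow_le_pow_left₀ (abs_nonneg _) (abs_trinomialSymbol_le_exp habs) n).trans_eq ?_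
      have hn' : (n : ℝ) ≠ 0 := (sqrt_pos.1 hn).ne'
      rw [← exp_nat_mul, div_pow, sq_sqrt (Nat.cast_nonneg n)]
      congr 1
      field_simp
    · rw [indicator_of_notMem ht, norm_zero]
      positivity
  · refine Eventually.of_forall fun t => (tendsto_trinomialSymbol_pow t).congr' ?_
    have hwidth : Tendsto (fun n : ℕ => π * √(n : ℝ)) atTop atTop :=
      (tendsto_sqrt_atTop.comp tendsto_natCast_atTop_atTop).const_mul_atTop pi_pos
    filter_upwards [hwidth.eventually_gt_atTop |t|] with n hn
    rw [indicator_of_mem]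
    exact ⟨(abs_lt.1 hn).1, (abs_lt.1 hn).2.le⟩

/-- The rescaled form of the integral representation. -/
lemma integral_trinomialSymbol_pow_eq {n : ℕ} (hn : 0 < n) :
    ∫ t in -(π * √n)..π * √n, trinomialSymbol (t / √n) ^ n =
      2 * π * √n * centralTrinomial n / 3 ^ n := by
  have hn' : √(n : ℝ) ≠ 0 := by positivity
  rw [intervalIntegral.integral_comp_div (fun θ => trinomialSymbol θ ^ n) hn', neg_div,
    mul_div_cancel_right₀ _ hn', centralTrinomial_eq_integral]
  simp only [trinomialSymbol, div_pow, intervalIntegral.integral_div, smul_eq_mul]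
  field_simp

open Filter in
/-- The asymptotic `T_n ~ (√3/(2√(πn)))·3^n` for the central
trinomial coefficients. -/
theorem centralTrinomial_asymptotic :
    Tendsto (fun n : ℕ =>
        (centralTrinomial n : ℝ) * (2 * Real.sqrt (Real.pi * n)) /
          (Real.sqrt 3 * 3 ^ n))
      atTop (nhds 1) := by
  have hlim := tendsto_integral_trinomialSymbol_pow.div_const √(3 * π)
  rw [div_self (by positivity)] at hlim
  refine hlim.congr' ?_
  filter_upwards [eventually_gt_atTop 0] with n hn
  rw [integral_trinomialSymbol_pow_eq hn, sqrt_mul (by norm_num), sqrt_mul pi_pos.le]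
  have hpi : √π ^ 2 = π := sq_sqrt pi_pos.le
  field_simp
  linear_combination -(centralTrinomial n : ℝ) * hpi
end
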